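/- Let F: 𝒮 × 𝒯 → 𝒰 be a biexact functor of triangulated categories that admits a strong Verdier structure. Then for all objects X, Y in 𝒮 and X', Y' in 𝒯, level_𝒰^{F(X,X')}(F(Y,Y')) ≤ level_𝒮^X(Y) + level_𝒯^{X'}(Y') − 1. -/

import Mathlib

open CategoryTheory Category Limits Pretriangulated

universe v₁ v₂ v₃ u₁ u₂ u₃

section Defs

variable {C : Type u₁} [Category.{v₁} C] [Preadditive C] [HasZeroObject C] [HasShift C ℤ]
  [∀ n : ℤ, (shiftFunctor C n).Additive] [Pretriangulated C] [HasBinaryBiproducts C]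

/-- The square with sides `f : T ⟶ U`, `g : T ⟶ V`, `g' : U ⟶ X`, `f' : V ⟶ X`
is homotopy cartesian. -/
def HomotopyCartesian {T U V X : C} (f : T ⟶ U) (g : T ⟶ V) (g' : U ⟶ X) (f' : V ⟶ X) : Prop :=
  ∃ δ : X ⟶ T⟦(1 : ℤ)⟧,
    Triangle.mk (biprod.lift f (-g)) (biprod.desc g' f') δ ∈ distTriang C

/-- The smallest class of objects containing `X` that is closed under (de)suspensions,
finite coproducts and retracts. -/
inductive Thick1 (X : C) : C → Prop
  | base : Thick1 X X
  | zero (Z : C) : Limits.IsZero Z → Thick1 X Z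
  | shift (n : ℤ) (Y : C) : Thick1 X Y → Thick1 X (Y⟦n⟧)
  | sum (Y Z : C) : Thick1 X Y → Thick1 X Z → Thick1 X (Y ⊞ Z)
  | retract (Y Z : C) (i : Z ⟶ Y) (r : Y ⟶ Z) : i ≫ r = 𝟙 Z → Thick1 X Y → Thick1 X Z

/-- `ThickN X n Y` means `Y ∈ thick^n_𝒯(X)`. -/
def ThickN (X : C) : ℕ → C → Prop
  | 0, Y => Limits.IsZero Y
  | 1, Y => Thick1 X Y
  | (n + 2), Y => ∃ (Y' Ytil Y'' : C) (a : Y' ⟶ Y ⊞ Ytil) (b : Y ⊞ Ytil ⟶ Y'')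
      (c : Y'' ⟶ Y'⟦(1 : ℤ)⟧), (Triangle.mk a b c ∈ distTriang C) ∧
      Thick1 X Y' ∧ ThickN X (n + 1) Y''

/-- The `X`-level of `Y`: the least `n` such that `Y ∈ thick^n(X)` (and `⊤` if there
is no such `n`). -/
noncomputable def level (X Y : C) : ℕ∞ :=
  sInf {n : ℕ∞ | ∃ m : ℕ, n = m ∧ ThickN X m Y}

end Defs

section Biexact

variable {C : Type u₁} [Category.{v₁} C] [Preadditive C] [HasZeroObject C] [HasShift C ℤ]
  [∀ n : ℤ, (shiftFunctor C n).Additive] [Pretriangulated C] [HasBinaryBiproducts C]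
variable {D : Type u₂} [Category.{v₂} D] [Preadditive D] [HasZeroObject D] [HasShift D ℤ]
  [∀ n : ℤ, (shiftFunctor D n).Additive] [Pretriangulated D] [HasBinaryBiproducts D]
variable {E : Type u₃} [Category.{v₃} E] [Preadditive E] [HasZeroObject E] [HasShift E ℤ]
  [∀ n : ℤ, (shiftFunctor E n).Additive] [Pretriangulated E] [HasBinaryBiproducts E]

/-- A biexact functor of triangulated categories: a bifunctor together with natural
isomorphisms `θ : F(Σⁿ-,-) ≅ ΣⁿF(-,-)` and `ζ : F(-,Σⁿ-) ≅ ΣⁿF(-,-)` which are exact in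
each variable and anticommute. -/
structure Biexact (F : C ⥤ D ⥤ E) where
  θ : ∀ (n : ℤ) (X : C) (X' : D), (F.obj (X⟦n⟧)).obj X' ≅ ((F.obj X).obj X')⟦n⟧
  ζ : ∀ (n : ℤ) (X : C) (X' : D), (F.obj X).obj (X'⟦n⟧) ≅ ((F.obj X).obj X')⟦n⟧
  θ_natural₁ : ∀ (n : ℤ) {X Y : C} (f : X ⟶ Y) (X' : D),
    (F.map (f⟦n⟧')).app X' ≫ (θ n Y X').hom = (θ n X X').hom ≫ ((F.map f).app X')⟦n⟧'
  θ_natural₂ : ∀ (n : ℤ) (X : C) {X' Y' : D} (g : X' ⟶ Y'),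
    (F.obj (X⟦n⟧)).map g ≫ (θ n X Y').hom = (θ n X X').hom ≫ (((F.obj X).map g)⟦n⟧')
  ζ_natural₁ : ∀ (n : ℤ) {X Y : C} (f : X ⟶ Y) (X' : D),
    (F.map f).app (X'⟦n⟧) ≫ (ζ n Y X').hom = (ζ n X X').hom ≫ (((F.map f).app X')⟦n⟧')
  ζ_natural₂ : ∀ (n : ℤ) (X : C) {X' Y' : D} (g : X' ⟶ Y'),
    (F.obj X).map (g⟦n⟧') ≫ (ζ n X Y').hom = (ζ n X X').hom ≫ (((F.obj X).map g)⟦n⟧')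
  ex₁ : ∀ (T : Triangle C), (T ∈ distTriang C) → ∀ (X' : D),
    Triangle.mk ((F.map T.mor₁).app X') ((F.map T.mor₂).app X')
      ((F.map T.mor₃).app X' ≫ (θ 1 T.obj₁ X').hom) ∈ distTriang E
  ex₂ : ∀ (X : C) (T : Triangle D), (T ∈ distTriang D) →
    Triangle.mk ((F.obj X).map T.mor₁) ((F.obj X).map T.mor₂)
      ((F.obj X).map T.mor₃ ≫ (ζ 1 X T.obj₁).hom) ∈ distTriang E
  anticomm : ∀ (X : C) (X' : D),
    (θ 1 X (X'⟦(1 : ℤ)⟧)).hom ≫ (((ζ 1 X X').hom)⟦(1 : ℤ)⟧') =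
      -((ζ 1 (X⟦(1 : ℤ)⟧) X').hom ≫ (((θ 1 X X').hom)⟦(1 : ℤ)⟧'))

/-- A biexact functor admits a strong Verdier structure: for every pair of exact triangles
there is an object `W` together with three exact triangles as in
Keller–Neeman/Aldrovandi–Lester, such that the resulting `4 × 4` diagram commutes and the
six designated squares are homotopy cartesian (the last one after changing a sign). -/
def StrongVerdier (F : C ⥤ D ⥤ E) (B : Biexact F) : Prop :=
  ∀ {X Y Z : C} {f : X ⟶ Y} {g : Y ⟶ Z} {h : Z ⟶ X⟦(1 : ℤ)⟧},
    (Triangle.mk f g h ∈ distTriang C) →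
  ∀ {X' Y' Z' : D} {f' : X' ⟶ Y'} {g' : Y' ⟶ Z'} {h' : Z' ⟶ X'⟦(1 : ℤ)⟧},
    (Triangle.mk f' g' h' ∈ distTriang D) →
  ∃ (W : E) (j : (F.obj X).obj Y' ⟶ W) (q : W ⟶ (F.obj Z).obj X')
    (i : W ⟶ (F.obj Y).obj Y') (p : (F.obj Z).obj Z' ⟶ W⟦(1 : ℤ)⟧)
    (j' : (F.obj Y).obj X' ⟶ W) (q' : W ⟶ (F.obj X).obj Z'),
    -- the three exact triangles
    (Triangle.mk j q ((F.map h).app X' ≫ (F.obj (X⟦(1 : ℤ)⟧)).map f' ≫ (B.θ 1 X Y').hom)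
        ∈ distTriang E) ∧
    (Triangle.mk i ((F.map g).app Y' ≫ (F.obj Z).map g') p ∈ distTriang E) ∧
    (Triangle.mk j' q' ((F.map f).app Z' ≫ (F.obj Y).map h' ≫ (B.ζ 1 Y X').hom)
        ∈ distTriang E) ∧
    -- the triangles (i)–(vi) commute
    j ≫ i = (F.map f).app Y' ∧
    j' ≫ i = (F.obj Y).map f' ∧
    j' ≫ q = (F.map g).app X' ∧
    j ≫ q' = (F.obj X).map g' ∧
    p ≫ (q'⟦(1 : ℤ)⟧') = (F.map h).app Z' ≫ (B.θ 1 X Z').hom ∧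
    p ≫ (q⟦(1 : ℤ)⟧') = (F.obj Z).map h' ≫ (B.ζ 1 Z X').hom ∧
    -- the squares (I)–(VI) are homotopy cartesian
    HomotopyCartesian ((F.map f).app X') ((F.obj X).map f') j' j ∧
    HomotopyCartesian i q ((F.map g).app Y') ((F.obj Z).map f') ∧
    HomotopyCartesian i q' ((F.obj Y).map g') ((F.map f).app Z') ∧
    HomotopyCartesian ((F.map h).app Y' ≫ (B.θ 1 X Y').hom) ((F.obj Z).map g')
      (j⟦(1 : ℤ)⟧') p ∧
    HomotopyCartesian ((F.map g).app Z') ((F.obj Y).map h' ≫ (B.ζ 1 Y X').hom) p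
      (j'⟦(1 : ℤ)⟧') ∧
    HomotopyCartesian q q' ((F.map h).app X' ≫ (B.θ 1 X X').hom)
      (-((F.obj X).map h' ≫ (B.ζ 1 X X').hom))

end Biexact

section Thick1

variable {C : Type u₁} [Category.{v₁} C] [Preadditive C] [HasShift C ℤ] [HasBinaryBiproducts C]

lemma Thick1.of_iso {X Y Z : C} (h : Thick1 X Y) (e : Y ≅ Z) : Thick1 X Z :=
  .retract Y Z e.inv e.hom e.inv_hom_id h

end Thick1

section Level

variable {C : Type u₁} [Category.{v₁} C] [Preadditive C] [HasZeroObject C] [HasShift C ℤ]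
  [∀ n : ℤ, (shiftFunctor C n).Additive] [Pretriangulated C]

lemma exists_desc_of_distTriang {X Y Z V : C} {a : X ⟶ Y} {b : Y ⟶ Z} {c : Z ⟶ X⟦(1 : ℤ)⟧}
    (hT : Triangle.mk a b c ∈ distTriang C) (f : Y ⟶ V) (h : a ≫ f = 0) :
    ∃ g : Z ⟶ V, f = b ≫ g :=
  Triangle.yoneda_exact₂ _ hT f h

lemma exists_lift_of_distTriang {X Y Z U : C} {a : X ⟶ Y} {b : Y ⟶ Z} {c : Z ⟶ X⟦(1 : ℤ)⟧}
    (hT : Triangle.mk a b c ∈ distTriang C) (f : U ⟶ Y) (h : f ≫ b = 0) :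
    ∃ g : U ⟶ X, f = g ≫ a :=
  Triangle.coyoneda_exact₂ _ hT f h

lemma exists_map_of_distTriang {X Y Z Y' Z' : C} {a : X ⟶ Y} {b : Y ⟶ Z} {c : Z ⟶ X⟦(1 : ℤ)⟧}
    (hT : Triangle.mk a b c ∈ distTriang C) {a' : X ⟶ Y'} {b' : Y' ⟶ Z'}
    {c' : Z' ⟶ X⟦(1 : ℤ)⟧} (hT' : Triangle.mk a' b' c' ∈ distTriang C) (t : Z ⟶ Z')
    (ht : c = t ≫ c') : ∃ z : Y ⟶ Y', a ≫ z = a' ∧ b ≫ t = z ≫ b' := by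
  obtain ⟨z, hz₁, hz₂⟩ := complete_distinguished_triangle_morphism₂ _ _ hT hT' (𝟙 X) t
    (by
      change c ≫ (shiftFunctor C (1 : ℤ)).map (𝟙 X) = t ≫ c'
      rw [CategoryTheory.Functor.map_id, comp_id, ht])
  exact ⟨z, hz₁.trans (id_comp a'), hz₂⟩

lemma exists_weak_pullback {A B Z T : C} {a : A ⟶ B} {b : B ⟶ Z} {c : Z ⟶ A⟦(1 : ℤ)⟧}
    (hT : Triangle.mk a b c ∈ distTriang C) (t : T ⟶ Z) :
    ∃ (P : C) (x : A ⟶ P) (y : P ⟶ T) (z : P ⟶ B),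
      Triangle.mk x y (t ≫ c) ∈ distTriang C ∧ z ≫ b = y ≫ t ∧
      ∀ {U : C} (f : U ⟶ B) (g : U ⟶ T), f ≫ b = g ≫ t → ∃ l : U ⟶ P, l ≫ z = f := by
  obtain ⟨P, x, y, hP⟩ := distinguished_cocone_triangle₂ (t ≫ c)
  obtain ⟨z, hz₁, hz₂⟩ := exists_map_of_distTriang hP hT t rfl
  refine ⟨P, x, y, z, hP, hz₂.symm, fun {U} f g h => ?_⟩
  have hbc : b ≫ c = 0 := comp_distTriang_mor_zero₂₃ _ hT
  obtain ⟨l, hl⟩ : ∃ l : U ⟶ P, g = l ≫ y := Triangle.coyoneda_exact₃ _ hP g (by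
    change g ≫ t ≫ c = 0
    rw [← assoc, ← h, assoc, hbc, comp_zero])
  obtain ⟨d, hd⟩ := exists_lift_of_distTriang hT (f - l ≫ z) (by
    rw [Preadditive.sub_comp, assoc, ← hz₂, ← assoc, ← hl, h, sub_self])
  refine ⟨l + d ≫ x, ?_⟩
  rw [Preadditive.add_comp, assoc, hz₁, ← hd]
  abel

lemma distTriang_of_iso₂ {X Y Y' Z : C} {a : X ⟶ Y} {b : Y ⟶ Z} {c : Z ⟶ X⟦(1 : ℤ)⟧}
    (hT : Triangle.mk a b c ∈ distTriang C) (e : Y ≅ Y') :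
    Triangle.mk (a ≫ e.hom) (e.inv ≫ b) c ∈ distTriang C := by
  have h₁ : (a ≫ e.hom) ≫ e.inv = 𝟙 X ≫ a := by simp
  have h₂ : (e.inv ≫ b) ≫ 𝟙 Z = e.inv ≫ b := by simp
  have h₃ : c ≫ (shiftFunctor C (1 : ℤ)).map (𝟙 X) = 𝟙 Z ≫ c := by simp
  exact isomorphic_distinguished _ hT _
    (Triangle.isoMk _ _ (Iso.refl _) e.symm (Iso.refl _) h₁ h₂ h₃)

variable [HasBinaryBiproducts C]

/-- An extension of an object of `thick^(n+1)` by one of `thick^1` has all its retracts in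
`thick^(n+2)`. -/
lemma ThickN.of_retract_of_distTriang {X A Q T Y : C} {n : ℕ} {a : A ⟶ Q} {b : Q ⟶ T}
    {c : T ⟶ A⟦(1 : ℤ)⟧} (hT : Triangle.mk a b c ∈ distTriang C) (hA : Thick1 X A)
    (hn : ThickN X (n + 1) T) (i : Y ⟶ Q) (r : Q ⟶ Y) (hir : i ≫ r = 𝟙 Y) :
    ThickN X (n + 2) Y := by
  obtain ⟨K, k, d, hK⟩ := distinguished_cocone_triangle i
  have hi : Mono i := ⟨fun u v huv => by
    simpa [hir] using congrArg (· ≫ r) huv⟩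
  obtain ⟨e, -, -⟩ := exists_iso_binaryBiproduct_of_distTriang _ hK
    (Triangle.mor₃_eq_zero_of_mono₁ _ hK hi)
  exact ⟨A, K, T, _, _, c, distTriang_of_iso₂ hT e, hA, hn⟩

lemma ThickN.retract {X Y Z : C} : ∀ {n : ℕ}, ThickN X n Y → ∀ (i : Z ⟶ Y) (r : Y ⟶ Z),
    i ≫ r = 𝟙 Z → ThickN X n Z
  | 0, h, i, r, hir => by
    have h' : IsZero Y := h
    exact (IsZero.iff_id_eq_zero Z).2 (by rw [← hir, h'.eq_of_tgt i 0, zero_comp])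
  | 1, h, i, r, hir => Thick1.retract Y Z i r hir h
  | n + 2, h, i, r, hir => by
    obtain ⟨Y', Ytil, Y'', a, b, c, hT, hY', hY''⟩ := h
    exact ThickN.of_retract_of_distTriang hT hY' hY'' (i ≫ biprod.inl) (biprod.fst ≫ r)
      (by simp [hir])

/-- A morphism `p` is a peeling with respect to `X` if its fibre lies in `thick^1(X)`. -/
def Peel (X : C) {V V₁ : C} (p : V ⟶ V₁) : Prop :=
  ∃ (A : C) (a : A ⟶ V) (c : V₁ ⟶ A⟦(1 : ℤ)⟧),
    Triangle.mk a p c ∈ distTriang C ∧ Thick1 X A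

lemma Peel.id (X V : C) : Peel X (𝟙 V) :=
  ⟨_, _, _, contractible_distinguished₁ V, .zero _ (isZero_zero C)⟩

lemma exists_peel {X A V : C} (hA : Thick1 X A) (a : A ⟶ V) :
    ∃ (V₁ : C) (p : V ⟶ V₁), Peel X p ∧ a ≫ p = 0 := by
  obtain ⟨V₁, p, c, h⟩ := distinguished_cocone_triangle a
  exact ⟨V₁, p, ⟨A, a, c, h, hA⟩, comp_distTriang_mor_zero₁₂ _ h⟩

/-- Peelings can be pushed forward along a morphism, killing in addition any given morphism
from an object of `thick^1`. -/
lemma Peel.exists_push {X V V₁ V' S : C} {p : V ⟶ V₁} (hp : Peel X p) (φ : V ⟶ V')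
    (hS : Thick1 X S) (s : S ⟶ V') :
    ∃ (V₁' : C) (p' : V' ⟶ V₁') (φ₁ : V₁ ⟶ V₁'), Peel X p' ∧ s ≫ p' = 0 ∧
      φ ≫ p' = p ≫ φ₁ := by
  obtain ⟨A, a, c, hT, hA⟩ := hp
  obtain ⟨V₁', p', hp', h⟩ := exists_peel (.sum _ _ hA hS) (biprod.desc (a ≫ φ) s)
  obtain ⟨φ₁, hφ₁⟩ := exists_desc_of_distTriang hT (φ ≫ p') (by
    simpa using congrArg (biprod.inl ≫ ·) h)
  exact ⟨V₁', p', φ₁, hp', by simpa using congrArg (biprod.inr ≫ ·) h, hφ₁⟩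

/-- A morphism is killed in `n` steps if it becomes zero after a composite of `n` peelings. -/
def Killed (X : C) : ℕ → {U V : C} → (U ⟶ V) → Prop
  | 0, _, _, f => f = 0
  | n + 1, _, V, f => ∃ (V₁ : C) (p : V ⟶ V₁), Peel X p ∧ Killed X n (f ≫ p)

lemma Killed.exists_factor {X : C} : ∀ {n : ℕ} {U V : C} {f : U ⟶ V}, Killed X (n + 1) f →
    ∃ (T : C) (g : U ⟶ T) (h : T ⟶ V), ThickN X (n + 1) T ∧ g ≫ h = f
  | 0, U, V, f, ⟨V₁, p, ⟨A, a, c, hT, hA⟩, hf⟩ => by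
    obtain ⟨g, hg⟩ := exists_lift_of_distTriang hT f hf
    exact ⟨A, g, a, hA, hg.symm⟩
  | n + 1, U, V, f, ⟨V₁, p, ⟨A, a, c, hT, hA⟩, hf⟩ => by
    obtain ⟨T, g, h, hTn, hgh⟩ := Killed.exists_factor hf
    obtain ⟨P, x, y, z, hP, -, hl⟩ := exists_weak_pullback hT h
    obtain ⟨l, hl⟩ := hl f g hgh.symm
    exact ⟨P, l, z, ThickN.of_retract_of_distTriang hP hA hTn (𝟙 P) (𝟙 P) (by simp), hl⟩

lemma ThickN.of_killed_id {X Y : C} {n : ℕ} (h : Killed X (n + 1) (𝟙 Y)) :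
    ThickN X (n + 1) Y := by
  obtain ⟨T, g, h, hT, hgh⟩ := h.exists_factor
  exact hT.retract g h hgh

/-- Finite sequences of peelings starting at a given object. -/
inductive PeelChain (X : C) : C → Type (max u₁ v₁)
  | nil (Y : C) : PeelChain X Y
  | cons {Y Y₁ : C} (p : Y ⟶ Y₁) (hp : Peel X p) (c : PeelChain X Y₁) : PeelChain X Y

namespace PeelChain

/-- The number of peelings in a chain. -/
def length {X : C} : {Y : C} → PeelChain X Y → ℕ
  | _, nil _ => 0
  | _, cons _ _ c => c.length + 1

/-- The composite of a chain of peelings kills the morphism `w`. -/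
def Kills {X : C} : {Y : C} → PeelChain X Y → {U : C} → (U ⟶ Y) → Prop
  | _, nil _, _, w => w = 0
  | _, cons p _ c, _, w => c.Kills (w ≫ p)

lemma Kills.precomp {X Y : C} {c : PeelChain X Y} {U U' : C} {w : U ⟶ Y} (h : c.Kills w)
    (u : U' ⟶ U) : c.Kills (u ≫ w) := by
  induction c with
  | nil => exact (congrArg (u ≫ ·) h).trans comp_zero
  | cons p hp c ih =>
    have := ih (w := w ≫ p) h
    rwa [← assoc] at this

end PeelChain

lemma ThickN.exists_peelChain {X : C} : ∀ {n : ℕ} {W : C}, ThickN X n W → ∀ {V : C} (w : W ⟶ V),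
    ∃ c : PeelChain X V, c.length = n ∧ c.Kills w
  | 0, W, h, V, w => ⟨.nil V, rfl, IsZero.eq_of_src h _ _⟩
  | 1, W, h, V, w => by
    obtain ⟨V₁, p, hp, hw⟩ := exists_peel (show Thick1 X W from h) w
    exact ⟨.cons p hp (.nil _), rfl, hw⟩
  | n + 2, W, h, V, w => by
    obtain ⟨A, W', W'', a, b, c, hT, hA, hW''⟩ := h
    obtain ⟨V₁, p, hp, hw⟩ := exists_peel hA (a ≫ biprod.fst ≫ w)
    obtain ⟨g, hg⟩ := exists_desc_of_distTriang hT (biprod.fst ≫ w ≫ p) (by simpa using hw)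
    obtain ⟨ch, hlen, hk⟩ := ThickN.exists_peelChain hW'' g
    refine ⟨.cons p hp ch, by simp [PeelChain.length, hlen], ?_⟩
    have h₁ : w ≫ p = (biprod.inl ≫ b) ≫ g := by
      rw [assoc]
      simpa using congrArg (biprod.inl ≫ ·) hg
    change ch.Kills (w ≫ p)
    rw [h₁]
    exact hk.precomp _

/-- The variant of `thick^(n+1)` built by adding objects of `thick^1` as third vertices. -/
def CothickN (X : C) : ℕ → C → Prop
  | 0, Y => Thick1 X Y
  | n + 1, Y => ∃ (P T Z : C) (a : T ⟶ P) (b : P ⟶ Z) (c : Z ⟶ T⟦(1 : ℤ)⟧) (i : Y ⟶ P)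
      (r : P ⟶ Y), Triangle.mk a b c ∈ distTriang C ∧ CothickN X n T ∧ Thick1 X Z ∧
      i ≫ r = 𝟙 Y

lemma CothickN.retract {X Y Y₀ : C} : ∀ {n : ℕ}, CothickN X n Y → ∀ (i : Y₀ ⟶ Y) (r : Y ⟶ Y₀),
    i ≫ r = 𝟙 Y₀ → CothickN X n Y₀
  | 0, h, i, r, hir => Thick1.retract Y Y₀ i r hir h
  | _ + 1, ⟨P, T, Z, a, b, c, i', r', hT, hn, hZ, hir'⟩, i, r, hir =>
    ⟨P, T, Z, a, b, c, i ≫ i', r' ≫ r, hT, hn, hZ, by simp [reassoc_of% hir', hir]⟩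

lemma CothickN.of_distTriang {X : C} : ∀ {n : ℕ} {A P Q : C} {a : A ⟶ P} {b : P ⟶ Q}
    {c : Q ⟶ A⟦(1 : ℤ)⟧}, Triangle.mk a b c ∈ distTriang C → Thick1 X A → CothickN X n Q →
    CothickN X (n + 1) P
  | 0, A, P, Q, a, b, c, hT, hA, hQ => ⟨P, A, Q, a, b, c, 𝟙 P, 𝟙 P, hT, hA, hQ, by simp⟩
  | n + 1, A, P, Q, a, b, c, hT, hA, ⟨Q₁, T, Z, a', b', c', i, r, hT', hTn, hZ, hir⟩ => by
    obtain ⟨P₂, x, y, z, hP₂, hzy, hlift⟩ := exists_weak_pullback hT (a' ≫ r)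
    have hP₂n : CothickN X (n + 1) P₂ := CothickN.of_distTriang hP₂ hA hTn
    obtain ⟨K, k, d, hK⟩ := distinguished_cocone_triangle z
    obtain ⟨S, s, e, hS⟩ := distinguished_cocone_triangle₁ (b ≫ i ≫ b')
    have hs : s ≫ b ≫ i ≫ b' = 0 := comp_distTriang_mor_zero₁₂ _ hS
    obtain ⟨g, hg⟩ := exists_lift_of_distTriang hT' (s ≫ b ≫ i) (by simpa only [assoc] using hs)
    obtain ⟨l, hl⟩ := hlift s g (by rw [← assoc, ← hg]; simp [hir])
    have hzk : z ≫ k = 0 := comp_distTriang_mor_zero₁₂ _ hK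
    obtain ⟨t, ht⟩ := exists_desc_of_distTriang hS k (by
      rw [← hl, assoc, hzk, comp_zero])
    obtain ⟨P₃, x', y', z', hP₃, -, hlift'⟩ := exists_weak_pullback hK t
    obtain ⟨l', hl'⟩ := hlift' (𝟙 P) (b ≫ i ≫ b') (by rw [id_comp, ht])
    exact ⟨P₃, P₂, Z, x', y', _, l', z', hP₃, hP₂n, hZ, hl'⟩

lemma ThickN.cothickN {X : C} : ∀ {n : ℕ} {Y : C}, ThickN X (n + 1) Y → CothickN X n Y
  | 0, _, h => h
  | _ + 1, _, ⟨_, _, _, _, _, _, hT, hA, hn⟩ =>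
    (CothickN.of_distTriang hT hA hn.cothickN).retract biprod.inl biprod.fst (by simp)

lemma level_eq_top_or_exists (X Y : C) :
    level X Y = ⊤ ∨ ∃ n : ℕ, level X Y = n ∧ ThickN X n Y := by
  by_cases h : {n : ℕ∞ | ∃ m : ℕ, n = m ∧ ThickN X m Y}.Nonempty
  · right
    obtain ⟨m, hm, hY⟩ := csInf_mem h
    exact ⟨m, hm, hY⟩
  · left
    rw [level, Set.not_nonempty_iff_eq_empty.1 h, sInf_empty]

lemma level_le {X Y : C} {n : ℕ} (h : ThickN X n Y) : level X Y ≤ n :=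
  sInf_le ⟨n, rfl, h⟩

end Level

section Extends

variable {C : Type u₁} [Category.{v₁} C] [Preadditive C] [HasZeroObject C] [HasShift C ℤ]
  [∀ n : ℤ, (shiftFunctor C n).Additive] [Pretriangulated C] [HasBinaryBiproducts C]
variable {D : Type u₂} [Category.{v₂} D]
variable {E : Type u₃} [Category.{v₃} E] [Preadditive E] [HasZeroObject E] [HasShift E ℤ]
  [∀ n : ℤ, (shiftFunctor E n).Additive] [Pretriangulated E] [HasBinaryBiproducts E]

/-- A morphism `f : F(Y, Y') ⟶ V` extends along a chain of peelings of `Y` if it can be continued,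
one peeling of `V` at a time, to compatible morphisms out of `F(Y_i, Y')`. -/
def PeelChain.Extends (G : E) (F : C ⥤ D ⥤ E) (Y' : D) {X : C} :
    {Y : C} → PeelChain X Y → {V : E} → ((F.obj Y).obj Y' ⟶ V) → Prop
  | _, .nil _, _, _ => True
  | _, .cons (Y₁ := Y₁) p _ c, V, f => ∃ (V₁ : E) (π : V ⟶ V₁) (f₁ : (F.obj Y₁).obj Y' ⟶ V₁),
      Peel G π ∧ f ≫ π = (F.map p).app Y' ≫ f₁ ∧ c.Extends G F Y' f₁

/-- A morphism `f : F(Y, Y') ⟶ V` extends along a chain of peelings of `Y` after `k` peelings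
of `V`. -/
def PeelChain.ExtendsAfter (G : E) (F : C ⥤ D ⥤ E) (Y' : D) {X Y : C} (c : PeelChain X Y) :
    ℕ → {V : E} → ((F.obj Y).obj Y' ⟶ V) → Prop
  | 0, _, f => c.Extends G F Y' f
  | k + 1, V, f => ∃ (V₁ : E) (π : V ⟶ V₁), Peel G π ∧ c.ExtendsAfter G F Y' k (f ≫ π)

namespace PeelChain

variable {G : E} {F : C ⥤ D ⥤ E} {X : C}

lemma Extends.postcomp {Y' : D} {Y : C} {c : PeelChain X Y} :
    ∀ {V V' : E} {f : (F.obj Y).obj Y' ⟶ V}, c.Extends G F Y' f → ∀ (φ : V ⟶ V'),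
      c.Extends G F Y' (f ≫ φ) := by
  induction c with
  | nil => intros; trivial
  | cons p hp c ih =>
    rintro V V' f ⟨V₁, π, f₁, hπ, hf, h⟩ φ
    obtain ⟨V₁', π', φ₁, hπ', -, hφ⟩ := hπ.exists_push φ (.zero _ (isZero_zero E)) 0
    exact ⟨V₁', π', f₁ ≫ φ₁, hπ', by rw [assoc, hφ, reassoc_of% hf], ih h φ₁⟩

lemma Extends.precomp {Y' Y'' : D} (g : Y'' ⟶ Y') {Y : C} {c : PeelChain X Y} :
    ∀ {V : E} {f : (F.obj Y).obj Y' ⟶ V}, c.Extends G F Y' f →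
      c.Extends G F Y'' ((F.obj Y).map g ≫ f) := by
  induction c with
  | nil => intros; trivial
  | cons p hp c ih =>
    rintro V f ⟨V₁, π, f₁, hπ, hf, h⟩
    exact ⟨V₁, π, (F.obj _).map g ≫ f₁, hπ, by simp [hf], ih h⟩

lemma ExtendsAfter.precomp {Y' Y'' : D} (g : Y'' ⟶ Y') {Y : C} {c : PeelChain X Y} :
    ∀ {k : ℕ} {V : E} {f : (F.obj Y).obj Y' ⟶ V}, c.ExtendsAfter G F Y' k f →
      c.ExtendsAfter G F Y'' k ((F.obj Y).map g ≫ f)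
  | 0, _, _, h => Extends.precomp g h
  | _ + 1, _, _, ⟨V₁, π, hπ, h⟩ => ⟨V₁, π, hπ, by simpa using h.precomp g⟩

end PeelChain

end Extends

section Bifunctor

open scoped ZeroObject

variable {C : Type u₁} [Category.{v₁} C] [Preadditive C] [HasZeroObject C] [HasShift C ℤ]
  [∀ n : ℤ, (shiftFunctor C n).Additive] [Pretriangulated C]
variable {D : Type u₂} [Category.{v₂} D] [Preadditive D] [HasZeroObject D] [HasShift D ℤ]
  [∀ n : ℤ, (shiftFunctor D n).Additive] [Pretriangulated D]
variable {E : Type u₃} [Category.{v₃} E] [Preadditive E] [HasZeroObject E] [HasShift E ℤ]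
  [∀ n : ℤ, (shiftFunctor E n).Additive] [Pretriangulated E]

namespace Biexact

variable {F : C ⥤ D ⥤ E}

lemma distTriang_left (B : Biexact F) {X Y Z : C} {f : X ⟶ Y} {g : Y ⟶ Z}
    {h : Z ⟶ X⟦(1 : ℤ)⟧} (hT : Triangle.mk f g h ∈ distTriang C) (X' : D) :
    Triangle.mk ((F.map f).app X') ((F.map g).app X') ((F.map h).app X' ≫ (B.θ 1 X X').hom) ∈
      distTriang E :=
  B.ex₁ _ hT X'

lemma distTriang_right (B : Biexact F) (X : C) {X' Y' Z' : D} {f : X' ⟶ Y'} {g : Y' ⟶ Z'}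
    {h : Z' ⟶ X'⟦(1 : ℤ)⟧} (hT : Triangle.mk f g h ∈ distTriang D) :
    Triangle.mk ((F.obj X).map f) ((F.obj X).map g) ((F.obj X).map h ≫ (B.ζ 1 X X').hom) ∈
      distTriang E :=
  B.ex₂ X _ hT

lemma map_zero_app (B : Biexact F) (X Y : C) (X' : D) : (F.map (0 : X ⟶ Y)).app X' = 0 := by
  have h : (F.map (𝟙 X)).app X' ≫ (F.map (0 : X ⟶ (0 : C))).app X' = 0 :=
    comp_distTriang_mor_zero₁₂ _ (B.ex₁ _ (contractible_distinguished X) X')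
  rw [F.map_id, NatTrans.id_app, id_comp] at h
  rw [← zero_comp (X := X) (f := (0 : (0 : C) ⟶ Y)), F.map_comp, NatTrans.comp_app, h, zero_comp]

lemma obj_map_zero (B : Biexact F) (X : C) (X' Y' : D) : (F.obj X).map (0 : X' ⟶ Y') = 0 := by
  have h : (F.obj X).map (𝟙 X') ≫ (F.obj X).map (0 : X' ⟶ (0 : D)) = 0 :=
    comp_distTriang_mor_zero₁₂ _ (B.ex₂ X _ (contractible_distinguished X'))
  rw [(F.obj X).map_id, id_comp] at h
  rw [← zero_comp (X := X') (f := (0 : (0 : D) ⟶ Y')), (F.obj X).map_comp, h, zero_comp]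

lemma isZero_obj_left (B : Biexact F) {X : C} (hX : IsZero X) (X' : D) :
    IsZero ((F.obj X).obj X') := by
  rw [IsZero.iff_id_eq_zero, ← NatTrans.id_app, ← F.map_id, hX.eq_of_src (𝟙 X) 0,
    B.map_zero_app]

lemma isZero_obj_right (B : Biexact F) (X : C) {X' : D} (hX' : IsZero X') :
    IsZero ((F.obj X).obj X') := by
  rw [IsZero.iff_id_eq_zero, ← (F.obj X).map_id, hX'.eq_of_src (𝟙 X') 0, B.obj_map_zero]

end Biexact

variable [HasBinaryBiproducts E]

/-- The middle term of a split exact triangle is a retract of the biproduct of the outer terms. -/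
lemma Thick1.of_split_distTriang {X A M Z : E} {i : A ⟶ M} {p : M ⟶ Z} {c : Z ⟶ A⟦(1 : ℤ)⟧}
    (hT : Triangle.mk i p c ∈ distTriang E) (s : Z ⟶ M) (r : M ⟶ A) (hir : i ≫ r = 𝟙 A)
    (hsp : s ≫ p = 𝟙 Z) (hsr : s ≫ r = 0) (hA : Thick1 X A) (hZ : Thick1 X Z) :
    Thick1 X M := by
  have hip : i ≫ p = 0 := comp_distTriang_mor_zero₁₂ _ hT
  obtain ⟨x, hx⟩ := exists_desc_of_distTriang hT (𝟙 M - (r ≫ i + p ≫ s)) (by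
    simp [Preadditive.comp_sub, reassoc_of% hir, reassoc_of% hip])
  have hx₀ : x = 0 := by
    have := congrArg (s ≫ ·) hx
    simpa [Preadditive.comp_sub, reassoc_of% hsr, reassoc_of% hsp] using this.symm
  rw [hx₀, comp_zero, sub_eq_zero] at hx
  exact .retract _ M (biprod.lift r p) (biprod.desc i s) (by rw [biprod.lift_desc, ← hx])
    (.sum _ _ hA hZ)

namespace Biexact

variable {F : C ⥤ D ⥤ E}

lemma thick1_obj_left [HasBinaryBiproducts C] (B : Biexact F) {G : E} {X A : C} {X' : D}
    (hA : Thick1 X A)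
    (h : Thick1 G ((F.obj X).obj X')) : Thick1 G ((F.obj A).obj X') := by
  induction hA with
  | base => exact h
  | zero Z hZ => exact .zero _ (B.isZero_obj_left hZ X')
  | shift n Y _ ih => exact (Thick1.shift n _ ih).of_iso (B.θ n Y X').symm
  | sum Y Z _ _ ihY ihZ =>
    have hT : Triangle.mk (biprod.inl : Y ⟶ Y ⊞ Z) (biprod.snd : Y ⊞ Z ⟶ Z) 0 ∈ distTriang C :=
      binaryBiproductTriangle_distinguished Y Z
    refine Thick1.of_split_distTriang (B.distTriang_left hT X')
      ((F.map biprod.inr).app X') ((F.map biprod.fst).app X') ?_ ?_ ?_ ihY ihZ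
    all_goals simp [← NatTrans.comp_app, ← F.map_comp, B.map_zero_app]
  | retract Y Z i r hir _ ih =>
    exact .retract _ _ ((F.map i).app X') ((F.map r).app X')
      (by rw [← NatTrans.comp_app, ← F.map_comp, hir, F.map_id, NatTrans.id_app]) ih

lemma thick1_obj_right [HasBinaryBiproducts D] (B : Biexact F) {G : E} {X : C} {X' A' : D}
    (hA' : Thick1 X' A')
    (h : Thick1 G ((F.obj X).obj X')) : Thick1 G ((F.obj X).obj A') := by
  induction hA' with
  | base => exact h
  | zero Z hZ => exact .zero _ (B.isZero_obj_right X hZ)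
  | shift n Y _ ih => exact (Thick1.shift n _ ih).of_iso (B.ζ n X Y).symm
  | sum Y Z _ _ ihY ihZ =>
    have hT : Triangle.mk (biprod.inl : Y ⟶ Y ⊞ Z) (biprod.snd : Y ⊞ Z ⟶ Z) 0 ∈ distTriang D :=
      binaryBiproductTriangle_distinguished Y Z
    refine Thick1.of_split_distTriang (B.distTriang_right X hT)
      ((F.obj X).map biprod.inr) ((F.obj X).map biprod.fst) ?_ ?_ ?_ ihY ihZ
    all_goals simp [← (F.obj X).map_comp, B.obj_map_zero]
  | retract Y Z i r hir _ ih =>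
    exact .retract _ _ ((F.obj X).map i) ((F.obj X).map r)
      (by rw [← (F.obj X).map_comp, hir, (F.obj X).map_id]) ih

lemma thick1_obj [HasBinaryBiproducts C] [HasBinaryBiproducts D] (B : Biexact F)
    {X A : C} {X' A' : D} (hA : Thick1 X A) (hA' : Thick1 X' A') :
    Thick1 ((F.obj X).obj X') ((F.obj A).obj A') :=
  B.thick1_obj_right hA' (B.thick1_obj_left hA .base)

end Biexact

variable [HasBinaryBiproducts C]

namespace PeelChain

variable {G : E} {F : C ⥤ D ⥤ E} {X : C}

lemma Extends.killed (B : Biexact F) {Y' : D} {Y : C} {c : PeelChain X Y} :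
    ∀ {U : C} {w : U ⟶ Y}, c.Kills w → ∀ {V : E} {f : (F.obj Y).obj Y' ⟶ V},
      c.Extends G F Y' f → Killed G c.length ((F.map w).app Y' ≫ f) := by
  induction c with
  | nil =>
    intro U w hw V f _
    change _ = 0
    rw [show w = 0 from hw, B.map_zero_app, zero_comp]
  | cons p hp c ih =>
    rintro U w hw V f ⟨V₁, π, f₁, hπ, hf, h⟩
    refine ⟨V₁, π, hπ, ?_⟩
    have := ih hw h
    simpa [hf] using this

lemma ExtendsAfter.killed (B : Biexact F) {Y' : D} {Y : C} {c : PeelChain X Y}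
    (hc : c.Kills (𝟙 Y)) : ∀ {k : ℕ} {V : E} {f : (F.obj Y).obj Y' ⟶ V},
      c.ExtendsAfter G F Y' k f → Killed G (c.length + k) f
  | 0, _, _, h => by simpa using Extends.killed B hc h
  | _ + 1, _, _, ⟨V₁, π, hπ, h⟩ => ⟨V₁, π, hπ, h.killed B hc⟩

variable [HasBinaryBiproducts D]

lemma extends_of_thick1 (B : Biexact F) {X' Y' : D} (hY' : Thick1 X' Y') {Y : C}
    (c : PeelChain X Y) :
    ∀ {V : E} (f : (F.obj Y).obj Y' ⟶ V), c.Extends ((F.obj X).obj X') F Y' f := by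
  induction c with
  | nil => intros; trivial
  | cons p hp c ih =>
    intro V f
    obtain ⟨A, a, d, hT, hA⟩ := hp
    obtain ⟨V₁, π, hπ, h⟩ := exists_peel (B.thick1_obj hA hY') ((F.map a).app Y' ≫ f)
    obtain ⟨f₁, hf₁⟩ := exists_desc_of_distTriang (B.distTriang_left hT Y') (f ≫ π)
      (by simpa using h)
    exact ⟨V₁, π, f₁, hπ, hf₁, ih f₁⟩

/-- If the restriction of `g` to `F(Y, X')` factors through a morphism on `F(Y₁, X')` which
extends along the rest of the chain, then `g` itself extends. -/
lemma Extends.of_restrict (B : Biexact F) (hV : StrongVerdier F B) {X₀' X' Y' Z' : D}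
    {f' : X' ⟶ Y'} {g' : Y' ⟶ Z'} {h' : Z' ⟶ X'⟦(1 : ℤ)⟧}
    (hT' : Triangle.mk f' g' h' ∈ distTriang D) (hZ' : Thick1 X₀' Z') {Y₁ : C}
    (c : PeelChain X Y₁) :
    ∀ {Y : C} (p : Y ⟶ Y₁) (hp : Peel X p) {V : E} (g : (F.obj Y).obj Y' ⟶ V)
      (h : (F.obj Y₁).obj X' ⟶ V),
      (F.obj Y).map f' ≫ g = (F.map p).app X' ≫ h →
      c.Extends ((F.obj X).obj X₀') F X' h →
      (cons p hp c).Extends ((F.obj X).obj X₀') F Y' g := by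
  have step : ∀ {Y Y₁ : C} (p : Y ⟶ Y₁) (_ : Peel X p) {V : E} (g : (F.obj Y).obj Y' ⟶ V)
      (h : (F.obj Y₁).obj X' ⟶ V), (F.obj Y).map f' ≫ g = (F.map p).app X' ≫ h →
      ∃ (S : E) (_ : Thick1 ((F.obj X).obj X₀') S) (s : S ⟶ V),
        ∀ {V₁ : E} (π : V ⟶ V₁), s ≫ π = 0 → ∃ g₁ : (F.obj Y₁).obj Y' ⟶ V₁,
          g ≫ π = (F.map p).app Y' ≫ g₁ ∧ (F.obj Y₁).map f' ≫ g₁ = h ≫ π := by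
    intro Y Y₁ p hp V g h hgh
    obtain ⟨A, a, d, hT, hA⟩ := hp
    obtain ⟨W, j, q, i, p', j', q', -, -, hj', -, hj'i, hj'q, -, -, -, -, ⟨δ, hδ⟩, -⟩ := hV hT hT'
    obtain ⟨s, hs⟩ := exists_desc_of_distTriang hj' (i ≫ g - q ≫ h) (by
      rw [Preadditive.comp_sub, reassoc_of% hj'i, reassoc_of% hj'q, hgh, sub_self])
    refine ⟨_, B.thick1_obj hA hZ', s, fun {V₁} π hsπ => ?_⟩
    have hW : i ≫ g ≫ π = q ≫ h ≫ π := by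
      rw [← sub_eq_zero, ← assoc, ← assoc, ← Preadditive.sub_comp, hs, assoc, hsπ, comp_zero]
    obtain ⟨g₁, hg₁⟩ := exists_desc_of_distTriang hδ (biprod.desc (g ≫ π) (h ≫ π)) (by
      rw [biprod.lift_desc, hW]
      simp)
    exact ⟨g₁, by simpa using congrArg (biprod.inl ≫ ·) hg₁,
      by simpa using (congrArg (biprod.inr ≫ ·) hg₁).symm⟩
  induction c with
  | nil Y₁ =>
    intro Y p hp V g h hgh _
    obtain ⟨S, hS, s, hs⟩ := step p hp g h hgh
    obtain ⟨V₁, π, hπ, hsπ⟩ := exists_peel hS s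
    obtain ⟨g₁, hg₁, -⟩ := hs π hsπ
    exact ⟨V₁, π, g₁, hπ, hg₁, trivial⟩
  | cons p₁ hp₁ c ih =>
    rintro Y p hp V g h hgh ⟨V₁, π, h₁, hπ, hh₁, hc⟩
    obtain ⟨S, hS, s, hs⟩ := step p hp g h hgh
    obtain ⟨V₁', π', φ, hπ', hsπ', hφ⟩ := hπ.exists_push (𝟙 V) hS s
    obtain ⟨g₁, hg₁, hg₁'⟩ := hs π' hsπ'
    refine ⟨V₁', π', g₁, hπ', hg₁, ih p₁ hp₁ g₁ (h₁ ≫ φ) ?_ (hc.postcomp φ)⟩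
    rw [hg₁', ← id_comp π', hφ, reassoc_of% hh₁]

lemma ExtendsAfter.of_restrict (B : Biexact F) (hV : StrongVerdier F B) {X₀' X' Y' Z' : D}
    {f' : X' ⟶ Y'} {g' : Y' ⟶ Z'} {h' : Z' ⟶ X'⟦(1 : ℤ)⟧}
    (hT' : Triangle.mk f' g' h' ∈ distTriang D) (hZ' : Thick1 X₀' Z') {Y : C}
    (c : PeelChain X Y) :
    ∀ {k : ℕ} {V : E} (g : (F.obj Y).obj Y' ⟶ V),
      c.ExtendsAfter ((F.obj X).obj X₀') F X' k ((F.obj Y).map f' ≫ g) →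
      c.ExtendsAfter ((F.obj X).obj X₀') F Y' (k + 1) g
  | 0, V, g, h => by
    cases c with
    | nil => exact ⟨V, 𝟙 V, Peel.id _ V, trivial⟩
    | cons p hp c =>
      obtain ⟨V₁, π, h₁, hπ, hh₁, hc⟩ := h
      exact ⟨V₁, π, hπ, Extends.of_restrict B hV hT' hZ' c p hp (g ≫ π) h₁ (by simpa using hh₁) hc⟩
  | k + 1, V, g, ⟨V₁, π, hπ, h⟩ =>
    ⟨V₁, π, hπ, ExtendsAfter.of_restrict B hV hT' hZ' c (g ≫ π) (by simpa using h)⟩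

lemma extendsAfter_of_cothickN (B : Biexact F) (hV : StrongVerdier F B) {X' : D} {Y : C}
    (c : PeelChain X Y) : ∀ {k : ℕ} {Y' : D}, CothickN X' k Y' →
      ∀ {V : E} (f : (F.obj Y).obj Y' ⟶ V), c.ExtendsAfter ((F.obj X).obj X') F Y' k f
  | 0, _, h, _, f => extends_of_thick1 B h c f
  | _ + 1, _, ⟨_, _, _, _, _, _, i, r, hT, hn, hZ, hir⟩, _, f => by
    have := (ExtendsAfter.of_restrict B hV hT hZ c ((F.obj Y).map r ≫ f)
      (extendsAfter_of_cothickN B hV c hn _)).precomp i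
    rwa [← assoc, ← (F.obj Y).map_comp, hir, (F.obj Y).map_id, id_comp] at this

end PeelChain

lemma ThickN.biexact [HasBinaryBiproducts D] {F : C ⥤ D ⥤ E} (B : Biexact F)
    (hV : StrongVerdier F B) {X Y : C} {X' Y' : D} {n m : ℕ}
    (hY : ThickN X (n + 1) Y) (hY' : ThickN X' (m + 1) Y') :
    ThickN ((F.obj X).obj X') (n + m + 1) ((F.obj Y).obj Y') := by
  obtain ⟨c, hlen, hc⟩ := hY.exists_peelChain (𝟙 Y)
  refine ThickN.of_killed_id ?_
  have := (c.extendsAfter_of_cothickN B hV hY'.cothickN (𝟙 _)).killed B hc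
  rwa [hlen, Nat.add_right_comm] at this

end Bifunctor

section

variable {C : Type u₁} [Category.{v₁} C] [Preadditive C] [HasZeroObject C] [HasShift C ℤ]
  [∀ n : ℤ, (shiftFunctor C n).Additive] [Pretriangulated C] [HasBinaryBiproducts C]
variable {D : Type u₂} [Category.{v₂} D] [Preadditive D] [HasZeroObject D] [HasShift D ℤ]
  [∀ n : ℤ, (shiftFunctor D n).Additive] [Pretriangulated D] [HasBinaryBiproducts D]
variable {E : Type u₃} [Category.{v₃} E] [Preadditive E] [HasZeroObject E] [HasShift E ℤ]
  [∀ n : ℤ, (shiftFunctor E n).Additive] [Pretriangulated E] [HasBinaryBiproducts E]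

/-- The level inequality for a biexact functor admitting a strong Verdier structure:
`level_{𝒰}^{F(X,X')} F(Y,Y') ≤ level_𝒮^X Y + level_𝒯^{X'} Y' - 1`. -/
theorem level_biexact (F : C ⥤ D ⥤ E) (B : Biexact F) (hV : StrongVerdier F B)
    (X Y : C) (X' Y' : D) :
    level ((F.obj X).obj X') ((F.obj Y).obj Y') ≤ level X Y + level X' Y' - 1 := by
  have hzero : IsZero ((F.obj Y).obj Y') →
      level ((F.obj X).obj X') ((F.obj Y).obj Y') ≤ level X Y + level X' Y' - 1 := fun h =>
    (level_le (n := 0) h).trans (by simp)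
  rcases level_eq_top_or_exists X' Y' with h' | ⟨_ | m, hm, hY'⟩
  · simp [h']
  · exact hzero (B.isZero_obj_right Y hY')
  · rcases level_eq_top_or_exists X Y with h | ⟨_ | n, hn, hY⟩
    · simp [h]
    · exact hzero (B.isZero_obj_left hY Y')
    · refine (level_le (ThickN.biexact B hV hY hY')).trans ?_
      rw [hn, hm]
      norm_cast
      lia

end
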